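/- Let N ≥ 2 and W ∈ ℝ^{N×N}. If W is cyclic, then for (Lebesgue-)almost every v ∈ ℝ^N the Krylov matrix K(W,v) is nonsingular; that is, the set { v ∈ ℝ^N : det K(W,v) = 0 } has Lebesgue measure zero. -/

import Mathlib

open Matrix MeasureTheory

/-- The Krylov matrix whose `k`-th column (`k = 0,1,…,N-1`) is `W^k v`. -/
def krylov {N : ℕ} (W : Matrix (Fin N) (Fin N) ℝ) (v : Fin N → ℝ) :
    Matrix (Fin N) (Fin N) ℝ :=
  Matrix.of fun i k => ((W ^ (k : ℕ)) *ᵥ v) i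

/-- The real vectors orthogonal (bilinearly) to a nonzero complex vector are a null set. -/
lemma null_of_orth {N : ℕ} (u : Fin N → ℂ) (hu : u ≠ 0) :
    volume {v : Fin N → ℝ | u ⬝ᵥ (fun i => (v i : ℂ)) = 0} = 0 := by
  let S : Submodule ℝ (Fin N → ℝ) :=
    { carrier := {v : Fin N → ℝ | u ⬝ᵥ (fun i => (v i : ℂ)) = 0}
      add_mem' := by
        intro a b ha hb
        simp only [Set.mem_ofPred_eq, dotProduct, Pi.add_apply, Complex.ofReal_add, mul_add,
          Finset.sum_add_distrib] at *
        rw [ha, hb, add_zero]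
      zero_mem' := by simp [dotProduct]
      smul_mem' := by
        intro c a ha
        simp only [Set.mem_ofPred_eq, dotProduct, Pi.smul_apply, smul_eq_mul,
          Complex.ofReal_mul, mul_left_comm _ (c : ℂ), ← Finset.mul_sum] at *
        rw [ha, mul_zero] }
  have hS : S ≠ ⊤ := by
    intro h
    apply hu
    funext i
    have : (Pi.single i 1 : Fin N → ℝ) ∈ S := h ▸ Submodule.mem_top
    change u ⬝ᵥ (fun j => ((Pi.single i 1 : Fin N → ℝ) j : ℂ)) = 0 at this
    simpa [dotProduct, Pi.single_apply, apply_ite Complex.ofReal] using this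
  exact Measure.addHaar_submodule volume S hS

/-- A singular Krylov matrix gives a complex left eigenvector orthogonal to `v`. -/
lemma exists_left_eigenvector {N : ℕ} (A : Matrix (Fin N) (Fin N) ℂ) (v : Fin N → ℂ)
    (c : Fin N → ℂ) (hc : c ≠ 0) (h : ∀ k < N, c ⬝ᵥ (A ^ k *ᵥ v) = 0) :
    ∃ (lam : ℂ) (u : Fin N → ℂ), u ≠ 0 ∧ u ᵥ* (A - lam • 1) = 0 ∧ u ⬝ᵥ v = 0 := by
  have hall : ∀ k, c ⬝ᵥ (A ^ k *ᵥ v) = 0 := by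
    intro k
    rw [Matrix.pow_eq_aeval_mod_charpoly]
    have hN : 0 < N := by
      rcases Nat.eq_zero_or_pos N with h0 | h0
      · subst h0; exact absurd (Subsingleton.elim c 0) hc
      · exact h0
    have hd : (Polynomial.X ^ k %ₘ A.charpoly).natDegree < N := by
      have := Polynomial.natDegree_modByMonic_lt (Polynomial.X ^ k) A.charpoly_monic (by
        intro h1
        have := A.charpoly_natDegree_eq_dim
        rw [h1] at this
        simp at this
        omega)
      rwa [A.charpoly_natDegree_eq_dim, Fintype.card_fin] at this
    rw [Polynomial.aeval_eq_sum_range' hd, Matrix.sum_mulVec, dotProduct_sum]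
    refine Finset.sum_eq_zero fun i hi => ?_
    rw [Matrix.smul_mulVec, dotProduct_smul, h i (Finset.mem_range.1 hi), smul_zero]
  let S : Submodule ℂ (Fin N → ℂ) :=
    { carrier := {u | ∀ k, u ⬝ᵥ (A ^ k *ᵥ v) = 0}
      add_mem' := by
        intro a b ha hb k
        rw [add_dotProduct, ha k, hb k, add_zero]
      zero_mem' := by intro k; simp
      smul_mem' := by
        intro c a ha k
        rw [smul_dotProduct, ha k, smul_zero] }
  have hinv : ∀ x ∈ S, A.vecMulLinear x ∈ S := by
    intro x hx k
    have := hx (k + 1)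
    rw [pow_succ', ← Matrix.mulVec_mulVec, dotProduct_mulVec] at this
    exact this
  have : Nontrivial S := ⟨⟨c, hall⟩, 0, fun h => hc (congrArg Subtype.val h)⟩
  obtain ⟨lam, hlam⟩ := Module.End.exists_eigenvalue ((A.vecMulLinear).restrict hinv)
  obtain ⟨u, hu⟩ := hlam.exists_hasEigenvector
  refine ⟨lam, u.1, fun h => hu.2 (Subtype.ext h), ?_, ?_⟩
  · have := congrArg Subtype.val hu.apply_eq_smul
    change u.1 ᵥ* A = lam • u.1 at this
    rw [Matrix.vecMul_sub, this, Matrix.vecMul_smul, Matrix.vecMul_one, sub_self]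
  · simpa using u.2 0

/-- A one-dimensional left kernel. -/
lemma left_kernel_unique {N : ℕ} (hN : 0 < N) (B : Matrix (Fin N) (Fin N) ℂ)
    (hB : B.rank = N - 1) (u w : Fin N → ℂ) (hu0 : u ≠ 0) (hu : u ᵥ* B = 0)
    (hw : w ᵥ* B = 0) : ∃ a : ℂ, a • u = w := by
  have h1 := LinearMap.finrank_range_add_finrank_ker (Bᵀ).mulVecLin
  have h2 : Module.finrank ℂ (LinearMap.range (Bᵀ).mulVecLin) = N - 1 := by
    rw [← hB, ← Matrix.rank_transpose]; rfl
  have h3 : Module.finrank ℂ (LinearMap.ker (Bᵀ).mulVecLin) = 1 := by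
    rw [h2, Module.finrank_fin_fun] at h1; omega
  have mu : u ∈ LinearMap.ker (Bᵀ).mulVecLin := by
    simpa [LinearMap.mem_ker, Matrix.mulVec_transpose] using hu
  have mw : w ∈ LinearMap.ker (Bᵀ).mulVecLin := by
    simpa [LinearMap.mem_ker, Matrix.mulVec_transpose] using hw
  obtain ⟨a, ha⟩ := exists_smul_eq_of_finrank_eq_one h3
    (x := ⟨u, mu⟩) (fun h => hu0 (congrArg Subtype.val h)) ⟨w, mw⟩
  exact ⟨a, congrArg Subtype.val ha⟩

/-- If `W` is cyclic, i.e. every complex eigenvalue `λ` of the complexification of `W`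
has geometric multiplicity `1` (equivalently `rank (W - λ I) = N - 1` over `ℂ`), then for
Lebesgue-almost every `v ∈ ℝ^N` the Krylov matrix `K(W,v)` is nonsingular: the set of `v`
with `det K(W,v) = 0` has Lebesgue measure zero. -/
theorem krylov_nonsingular_ae_of_cyclic
    (N : ℕ) (hN : 2 ≤ N) (W : Matrix (Fin N) (Fin N) ℝ)
    (hW : ∀ lam : ℂ, (W.map (fun r : ℝ => (r : ℂ)) - lam • 1).det = 0 →
      (W.map (fun r : ℝ => (r : ℂ)) - lam • 1).rank = N - 1) :
    volume {v : Fin N → ℝ | (krylov W v).det = 0} = 0 := by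
  classical
  set A : Matrix (Fin N) (Fin N) ℂ := W.map (fun r : ℝ => (r : ℂ)) with hA
  have hApow : ∀ k, A ^ k = (W ^ k).map (fun r : ℝ => (r : ℂ)) := by
    intro k
    exact (map_pow (Complex.ofRealHom.mapMatrix (m := Fin N)) W k).symm
  let E : Set ℂ := {lam | (A - lam • 1).det = 0}
  have hE : E.Finite := by
    refine (A.charpoly.roots.toFinset.finite_toSet).subset ?_
    intro lam hlam
    have h0 : (A - lam • 1).det = 0 := hlam
    have : A.charpoly.eval lam = 0 := by
      rw [Matrix.eval_charpoly, ← neg_sub, Matrix.det_neg]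
      rw [Matrix.smul_one_eq_diagonal] at h0
      simp [Matrix.scalar_apply, h0]
    simpa [Polynomial.mem_roots A.charpoly_monic.ne_zero] using this
  let T : ℂ → Set (Fin N → ℝ) := fun lam =>
    {v | ∃ u : Fin N → ℂ, u ≠ 0 ∧ u ᵥ* (A - lam • 1) = 0 ∧ u ⬝ᵥ (fun i => (v i : ℂ)) = 0}
  have hT : ∀ lam ∈ E, volume (T lam) = 0 := by
    intro lam hlam
    obtain ⟨u, hu0, hu⟩ := Matrix.exists_vecMul_eq_zero_iff.2 hlam
    refine measure_mono_null ?_ (null_of_orth u hu0)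
    rintro v ⟨w, hw0, hw, hwv⟩
    obtain ⟨a, rfl⟩ := left_kernel_unique (by omega) _ (hW lam hlam) w u hw0 hw hu
    simp only [Set.mem_ofPred_eq]
    rw [smul_dotProduct, hwv, smul_zero]
  refine measure_mono_null ?_ ((measure_biUnion_null_iff hE.countable).2 hT)
  intro v hv
  obtain ⟨c, hc0, hc⟩ := Matrix.exists_vecMul_eq_zero_iff.2 hv
  obtain ⟨lam, u, hu0, hu, huv⟩ := exists_left_eigenvector A (fun i => (v i : ℂ))
    (fun i => (c i : ℂ))
    (fun h => hc0 (funext fun i => by simpa using congrFun h i))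
    (by
      intro k hk
      have := congrFun hc ⟨k, hk⟩
      simp only [Matrix.vecMul, krylov, dotProduct, Matrix.of_apply, Pi.zero_apply,
        Matrix.mulVec] at this
      rw [hApow]
      simp only [dotProduct, Matrix.mulVec, Matrix.map_apply]
      exact_mod_cast this)
  exact Set.mem_biUnion (show lam ∈ E from
    Matrix.exists_vecMul_eq_zero_iff.1 ⟨u, hu0, hu⟩) ⟨u, hu0, hu, huv⟩
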